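/- Let a, b, c, d be real numbers with a < b and c < d and let T = [a,b] × [c,d]. For any prescribed real numbers m, λ₁, λ₂, λ₃, λ₄ there exists a unique polynomial q(x,y) = c₀ + c₁x + c₂y + c₃x² + c₄y² in the span of {1, x, y, x², y²} such that the average of q over T equals m and the averages of q over the four edges {a}×[c,d], {b}×[c,d], [a,b]×{c}, [a,b]×{d} equal λ₁, λ₂, λ₃, λ₄ respectively. Equivalently, the linear map ℝ⁵ → ℝ⁵ sending (c₀,…,c₄) to these five averages is a linear isomorphism. -/

import Mathlib

open intervalIntegral

/-- Integral of a quadratic polynomial in one variable. -/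
lemma integral_quadratic (u v p q r : ℝ) :
    ∫ t in u..v, (p + q * t + r * t ^ 2) =
      (v - u) * (p + q * ((u + v) / 2) + r * ((u ^ 2 + u * v + v ^ 2) / 3)) := by
  rw [intervalIntegral.integral_add, intervalIntegral.integral_add,
    intervalIntegral.integral_const_mul, intervalIntegral.integral_const_mul,
    integral_id, integral_pow, intervalIntegral.integral_const]
  · simp only [smul_eq_mul]
    push_cast
    ring
  all_goals exact Continuous.intervalIntegrable (by fun_prop) _ _

/-- The averages of the five-parameter polynomial in closed form. -/
lemma averages_formula (a b c d : ℝ) (hab : a < b) (hcd : c < d) (e₀ e₁ e₂ e₃ e₄ : ℝ) :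
    let q : ℝ → ℝ → ℝ := fun x y => e₀ + e₁ * x + e₂ * y + e₃ * x ^ 2 + e₄ * y ^ 2
    (∫ x in a..b, ∫ y in c..d, q x y) / ((b - a) * (d - c)) =
      e₀ + e₁ * ((a + b) / 2) + e₂ * ((c + d) / 2) + e₃ * ((a ^ 2 + a * b + b ^ 2) / 3)
        + e₄ * ((c ^ 2 + c * d + d ^ 2) / 3) ∧
    (∀ x, (∫ y in c..d, q x y) / (d - c) =
      e₀ + e₁ * x + e₂ * ((c + d) / 2) + e₃ * x ^ 2 + e₄ * ((c ^ 2 + c * d + d ^ 2) / 3)) ∧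
    (∀ y, (∫ x in a..b, q x y) / (b - a) =
      e₀ + e₁ * ((a + b) / 2) + e₂ * y + e₃ * ((a ^ 2 + a * b + b ^ 2) / 3) + e₄ * y ^ 2) := by
  intro q
  have h1 : b - a ≠ 0 := (sub_pos.2 hab).ne'
  have h2 : d - c ≠ 0 := (sub_pos.2 hcd).ne'
  have hy : ∀ x, (∫ y in c..d, q x y) = (d - c) * (e₀ + e₁ * x + e₂ * ((c + d) / 2)
      + e₃ * x ^ 2 + e₄ * ((c ^ 2 + c * d + d ^ 2) / 3)) := by
    intro x
    have := integral_quadratic c d (e₀ + e₁ * x + e₃ * x ^ 2) e₂ e₄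
    rw [show (fun y => q x y) = fun t => (e₀ + e₁ * x + e₃ * x ^ 2) + e₂ * t + e₄ * t ^ 2 by
      funext t; simp only [q]; ring, this]
    ring
  have hx : ∀ y, (∫ x in a..b, q x y) = (b - a) * (e₀ + e₁ * ((a + b) / 2) + e₂ * y
      + e₃ * ((a ^ 2 + a * b + b ^ 2) / 3) + e₄ * y ^ 2) := by
    intro y
    have := integral_quadratic a b (e₀ + e₂ * y + e₄ * y ^ 2) e₁ e₃
    rw [show (fun x => q x y) = fun t => (e₀ + e₂ * y + e₄ * y ^ 2) + e₁ * t + e₃ * t ^ 2 by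
      funext t; simp only [q]; ring, this]
    ring
  refine ⟨?_, fun x => ?_, fun y => ?_⟩
  · simp only [hy]
    rw [intervalIntegral.integral_const_mul]
    have := integral_quadratic a b (e₀ + e₂ * ((c + d) / 2)
      + e₄ * ((c ^ 2 + c * d + d ^ 2) / 3)) e₁ e₃
    rw [show (fun x => e₀ + e₁ * x + e₂ * ((c + d) / 2)
      + e₃ * x ^ 2 + e₄ * ((c ^ 2 + c * d + d ^ 2) / 3)) = fun t => (e₀ + e₂ * ((c + d) / 2)
      + e₄ * ((c ^ 2 + c * d + d ^ 2) / 3)) + e₁ * t + e₃ * t ^ 2 by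
      funext t; ring, this, div_eq_iff (mul_ne_zero h1 h2)]
    ring
  · rw [hy, mul_div_cancel_left₀ _ h2]
  · rw [hx, mul_div_cancel_left₀ _ h1]

/-- On the rectangle `T = [a,b] × [c,d]` (with `a < b`, `c < d`), for any prescribed
mean value `m` over `T` and mean values `λ₁, λ₂, λ₃, λ₄` over the four edges
`{a}×[c,d]`, `{b}×[c,d]`, `[a,b]×{c}`, `[a,b]×{d}`, there is a unique polynomial
`q(x,y) = c₀ + c₁x + c₂y + c₃x² + c₄y²` in `Span{1, x, y, x², y²}` attaining exactly
these five averages; equivalently, the linear map sending `(c₀,…,c₄)` to the five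
averages is a linear isomorphism. -/
theorem postprocessed_pressure_unisolvence
    (a b c d : ℝ) (hab : a < b) (hcd : c < d)
    (m lam₁ lam₂ lam₃ lam₄ : ℝ) :
    ∃! cf : Fin 5 → ℝ,
      (let q : ℝ → ℝ → ℝ := fun x y => cf 0 + cf 1 * x + cf 2 * y + cf 3 * x ^ 2 + cf 4 * y ^ 2
      (∫ x in a..b, ∫ y in c..d, q x y) / ((b - a) * (d - c)) = m ∧
      (∫ y in c..d, q a y) / (d - c) = lam₁ ∧
      (∫ y in c..d, q b y) / (d - c) = lam₂ ∧
      (∫ x in a..b, q x c) / (b - a) = lam₃ ∧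
      (∫ x in a..b, q x d) / (b - a) = lam₄) := by
  have h1 : b - a ≠ 0 := (sub_pos.2 hab).ne'
  have h2 : d - c ≠ 0 := (sub_pos.2 hcd).ne'
  obtain ⟨k₃, hk₃⟩ : ∃ k, k = 3 * (lam₁ + lam₂ - 2 * m) / (b - a) ^ 2 := ⟨_, rfl⟩
  obtain ⟨k₄, hk₄⟩ : ∃ k, k = 3 * (lam₃ + lam₄ - 2 * m) / (d - c) ^ 2 := ⟨_, rfl⟩
  obtain ⟨k₁, hk₁⟩ : ∃ k, k = (lam₂ - lam₁) / (b - a) - k₃ * (a + b) := ⟨_, rfl⟩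
  obtain ⟨k₂, hk₂⟩ : ∃ k, k = (lam₄ - lam₃) / (d - c) - k₄ * (c + d) := ⟨_, rfl⟩
  have g₃ : k₃ * (b - a) ^ 2 = 3 * (lam₁ + lam₂ - 2 * m) := by
    rw [hk₃]; field_simp
  have g₄ : k₄ * (d - c) ^ 2 = 3 * (lam₃ + lam₄ - 2 * m) := by
    rw [hk₄]; field_simp
  have g₁ : (k₁ + k₃ * (a + b)) * (b - a) = lam₂ - lam₁ := by
    rw [hk₁]; field_simp; ring
  have g₂ : (k₂ + k₄ * (c + d)) * (d - c) = lam₄ - lam₃ := by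
    rw [hk₂]; field_simp; ring
  clear hk₁ hk₂ hk₃ hk₄
  refine ⟨![m - k₁ * ((a + b) / 2) - k₂ * ((c + d) / 2) - k₃ * ((a ^ 2 + a * b + b ^ 2) / 3)
        - k₄ * ((c ^ 2 + c * d + d ^ 2) / 3), k₁, k₂, k₃, k₄], ?_, ?_⟩
  · beta_reduce
    intro q
    obtain ⟨A, B, C⟩ := averages_formula a b c d hab hcd
      (m - k₁ * ((a + b) / 2) - k₂ * ((c + d) / 2) - k₃ * ((a ^ 2 + a * b + b ^ 2) / 3)
        - k₄ * ((c ^ 2 + c * d + d ^ 2) / 3)) k₁ k₂ k₃ k₄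
    refine ⟨A.trans ?_, (B a).trans ?_, (B b).trans ?_, (C c).trans ?_, (C d).trans ?_⟩
    · ring
    · linear_combination g₃ / 6 - g₁ / 2
    · linear_combination g₃ / 6 + g₁ / 2
    · linear_combination g₄ / 6 - g₂ / 2
    · linear_combination g₄ / 6 + g₂ / 2
  · intro e he
    obtain ⟨A, B, C⟩ := averages_formula a b c d hab hcd (e 0) (e 1) (e 2) (e 3) (e 4)
    obtain ⟨E₀, E₁, E₂, E₃, E₄⟩ := he
    have E₀ := A.symm.trans E₀
    have E₁ := (B a).symm.trans E₁
    have E₂ := (B b).symm.trans E₂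
    have E₃ := (C c).symm.trans E₃
    have E₄ := (C d).symm.trans E₄
    clear A B C
    have f₃ : e 3 = k₃ := by
      apply mul_right_cancel₀ (pow_ne_zero 2 h1)
      linear_combination 3 * (E₁ + E₂ - 2 * E₀) - g₃
    have f₄ : e 4 = k₄ := by
      apply mul_right_cancel₀ (pow_ne_zero 2 h2)
      linear_combination 3 * (E₃ + E₄ - 2 * E₀) - g₄
    rw [f₃, f₄] at E₀ E₁ E₂ E₃ E₄
    have f₁ : e 1 = k₁ := by
      apply mul_right_cancel₀ h1
      linear_combination E₂ - E₁ - g₁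
    have f₂ : e 2 = k₂ := by
      apply mul_right_cancel₀ h2
      linear_combination E₄ - E₃ - g₂
    rw [f₁, f₂] at E₀
    funext i
    fin_cases i
    · change e 0 = m - _ - _ - _ - _
      linear_combination E₀
    · exact f₁
    · exact f₂
    · exact f₃
    · exact f₄
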